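/- arXiv:1405.1480 — 2 statements merged into one kernel-verified Lean document; each statement's English description precedes it below -/
import Mathlib

section
/- (Theorem 1) Consider the networked multiagent system ẋ(t) = −L(G)x(t) + L(G)ξ(t) − K₁x(t) + K₂c, ξ̇(t) = −L(G)x(t), with arbitrary initial conditions x(0) = x₀, ξ(0) = ξ₀, where G is a connected undirected simple graph on n vertices, K₂ is a nonzero 0–1 matrix, K₁ = diag with k₁,ᵢ = Σⱼ k₂,ᵢⱼ, and c ∈ ℝⁿ is the constant vector of exogenous inputs. Then for every differentiable solution (x, ξ) defined on [0, ∞), the state x(t) converges as t → ∞ to ε·1ₙ, where ε = (1ₙᵀK₂c)/(1ₙᵀK₂1ₙ) is the average of the applied exogenous inputs; that is, the error δ(t) = x(t) − ε·1ₙ asymptotically vanishes. -/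
open Matrix Filter

section Calculus

/-- A function differentiable on `[a, ∞)` with nonpositive derivative is antitone there. -/
lemma antitoneOn_Ici_of_hasDerivAt_nonpos {a : ℝ} {f f' : ℝ → ℝ}
    (hf : ∀ t, a ≤ t → HasDerivAt f (f' t) t) (hf' : ∀ t, a ≤ t → f' t ≤ 0) :
    AntitoneOn f (Set.Ici a) := by
  refine antitoneOn_of_hasDerivWithinAt_nonpos (f' := f') (convex_Ici a)
    (fun t ht => (hf t ht).continuousAt.continuousWithinAt) (fun t ht => ?_) (fun t ht => ?_)
  · exact (hf t (interior_subset ht)).hasDerivWithinAt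
  · exact hf' t (interior_subset ht)

/-- A Barbalat-type lemma: if `V` is bounded below and decreases at rate at least `W ≥ 0`, and the
derivative of `W` is bounded below, then `W` tends to `0`. -/
lemma tendsto_zero_of_hasDerivAt_le_neg {V V' W W' : ℝ → ℝ} {M : ℝ}
    (hV : ∀ t, 0 ≤ t → HasDerivAt V (V' t) t) (hV0 : ∀ t, 0 ≤ t → 0 ≤ V t)
    (hW : ∀ t, 0 ≤ t → HasDerivAt W (W' t) t) (hW0 : ∀ t, 0 ≤ t → 0 ≤ W t)
    (hVW : ∀ t, 0 ≤ t → V' t ≤ -W t) (hM : ∀ t, 0 ≤ t → -M ≤ W' t) :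
    Tendsto W atTop (nhds 0) := by
  have hVanti : AntitoneOn V (Set.Ici 0) := antitoneOn_Ici_of_hasDerivAt_nonpos hV
    fun t ht => (hVW t ht).trans (neg_nonpos.2 (hW0 t ht))
  obtain ⟨l, hl⟩ : ∃ l, Tendsto V atTop (nhds l) := by
    have hmax : Antitone fun t => V (max 0 t) := fun s t hst =>
      hVanti (le_max_left 0 s) (le_max_left 0 t) (max_le_max le_rfl hst)
    have hbdd : BddBelow (Set.range fun t => V (max 0 t)) :=
      ⟨0, by rintro _ ⟨t, rfl⟩; exact hV0 _ (le_max_left 0 t)⟩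
    refine ⟨_, (tendsto_atTop_ciInf hmax hbdd).congr' ?_⟩
    filter_upwards [eventually_ge_atTop 0] with t ht
    rw [max_eq_right ht]
  -- `W` decreases at rate at most `M`, which bounds `W t` by the loss of `V` on `[t, t + h]`.
  have hWlower : ∀ t s, 0 ≤ t → t ≤ s → W t - M * (s - t) ≤ W s := by
    intro t s ht hts
    have hanti : AntitoneOn (fun s => -W s - M * s) (Set.Ici t) := by
      refine antitoneOn_Ici_of_hasDerivAt_nonpos (f' := fun s => -W' s - M) (fun s hs => ?_)
        (fun s hs => by linarith [hM s (ht.trans hs)])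
      have := (hW s (ht.trans hs)).fun_neg.fun_sub ((hasDerivAt_id s).const_mul M)
      simpa using this
    have := hanti Set.self_mem_Ici (Set.mem_Ici.2 hts) hts
    simp only at this
    linarith
  have hWupper : ∀ t h, 0 ≤ t → 0 ≤ h → h * W t ≤ V t - V (t + h) + M * h ^ 2 / 2 := by
    intro t h ht hh
    have hanti : AntitoneOn (fun s => V s + (s - t) * W t - M * (s - t) ^ 2 / 2) (Set.Ici t) := by
      refine antitoneOn_Ici_of_hasDerivAt_nonpos (f' := fun s => V' s + W t - M * (s - t))
        (fun s hs => ?_)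
        (fun s hs => by linarith [hVW s (ht.trans hs), hWlower t s ht hs])
      have hid := (hasDerivAt_id s).sub_const t
      have := ((hV s (ht.trans hs)).fun_add (hid.mul_const (W t))).fun_sub
        (((hid.fun_pow 2).const_mul M).div_const 2)
      refine this.congr_deriv ?_
      simp
      ring
    have := hanti Set.self_mem_Ici (Set.mem_Ici.2 (le_add_of_nonneg_right hh))
      (le_add_of_nonneg_right hh)
    simp at this
    linarith
  rw [Metric.tendsto_atTop]
  intro r hr
  obtain ⟨h, hh, hMh⟩ : ∃ h : ℝ, 0 < h ∧ M * h < r := by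
    refine ⟨r / (2 * (|M| + 1)), by positivity, ?_⟩
    rw [← mul_div_assoc, div_lt_iff₀ (by positivity)]
    nlinarith [le_abs_self M, abs_nonneg M]
  have hdiff : Tendsto (fun t => V t - V (t + h)) atTop (nhds 0) := by
    simpa using hl.sub (hl.comp (tendsto_atTop_add_const_right _ h tendsto_id))
  obtain ⟨T, hT⟩ := eventually_atTop.1 (hdiff.eventually_lt_const (half_pos (mul_pos hh hr)))
  refine ⟨max 0 T, fun t ht => ?_⟩
  have ht0 : 0 ≤ t := (le_max_left _ _).trans ht
  rw [Real.dist_eq, sub_zero, abs_of_nonneg (hW0 t ht0)]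
  have hloss := hT t ((le_max_right _ _).trans ht)
  have hup := hWupper t h ht0 hh.le
  nlinarith

variable {ι : Type*} [Fintype ι]

lemma HasDerivAt.dotProduct_fun {u v : ℝ → ι → ℝ} {u' v' : ι → ℝ} {t : ℝ}
    (hu : HasDerivAt u u' t) (hv : HasDerivAt v v' t) :
    HasDerivAt (fun s => u s ⬝ᵥ v s) (u' ⬝ᵥ v t + u t ⬝ᵥ v') t := by
  simp only [dotProduct, ← Finset.sum_add_distrib]
  exact HasDerivAt.fun_sum fun i _ => (hasDerivAt_pi.1 hu i).fun_mul (hasDerivAt_pi.1 hv i)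

lemma HasDerivAt.mulVec_fun (A : Matrix ι ι ℝ) {u : ℝ → ι → ℝ} {u' : ι → ℝ} {t : ℝ}
    (hu : HasDerivAt u u' t) : HasDerivAt (fun s => A *ᵥ u s) (A *ᵥ u') t :=
  hasDerivAt_pi.2 fun i => HasDerivAt.fun_sum fun j _ => (hasDerivAt_pi.1 hu j).const_mul (A i j)

lemma norm_le_of_dotProduct_self_le {v : ι → ℝ} {R : ℝ} (h : v ⬝ᵥ v ≤ R) : ‖v‖ ≤ √R := by
  refine (pi_norm_le_iff_of_nonneg (Real.sqrt_nonneg R)).2 fun i => ?_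
  refine Real.le_sqrt_of_sq_le (le_trans ?_ h)
  rw [Real.norm_eq_abs, sq_abs, sq]
  exact Finset.single_le_sum (f := fun i => v i * v i) (fun j _ => mul_self_nonneg (v j))
    (Finset.mem_univ i)

/-- Along solutions of `δ' = -Fδ + Le`, `e' = -Lδ` with `L` symmetric and `F` positive
semidefinite, the dissipation `δᵀFδ` vanishes asymptotically. -/
lemma tendsto_dotProduct_mulVec_zero {F L : Matrix ι ι ℝ} (hL : L.IsSymm)
    (hF : ∀ v, 0 ≤ v ⬝ᵥ (F *ᵥ v)) {δ e : ℝ → ι → ℝ}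
    (hδ : ∀ t, 0 ≤ t → HasDerivAt δ (-(F *ᵥ δ t) + L *ᵥ e t) t)
    (he : ∀ t, 0 ≤ t → HasDerivAt e (-(L *ᵥ δ t)) t) :
    Tendsto (fun t => δ t ⬝ᵥ (F *ᵥ δ t)) atTop (nhds 0) := by
  have hself : ∀ v : ι → ℝ, 0 ≤ v ⬝ᵥ v := fun v =>
    Finset.sum_nonneg fun i _ => mul_self_nonneg (v i)
  let V : ℝ → ℝ := fun t => δ t ⬝ᵥ δ t + e t ⬝ᵥ e t
  have hV : ∀ t, 0 ≤ t → HasDerivAt V (-(2 * (δ t ⬝ᵥ (F *ᵥ δ t)))) t := by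
    intro t ht
    refine (((hδ t ht).dotProduct_fun (hδ t ht)).fun_add
      ((he t ht).dotProduct_fun (he t ht))).congr_deriv ?_
    have hcross : e t ⬝ᵥ (L *ᵥ δ t) = δ t ⬝ᵥ (L *ᵥ e t) := by
      rw [dotProduct_mulVec, ← mulVec_transpose, hL.eq, dotProduct_comm]
    rw [dotProduct_comm _ (δ t), dotProduct_comm _ (e t)]
    simp only [dotProduct_add, dotProduct_neg, hcross]
    ring
  have hVanti : AntitoneOn V (Set.Ici 0) := antitoneOn_Ici_of_hasDerivAt_nonpos hV
    fun t _ => by linarith [hF (δ t)]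
  have hVle : ∀ t, 0 ≤ t → V t ≤ V 0 := fun t ht => hVanti Set.self_mem_Ici ht ht
  let g : (ι → ℝ) × (ι → ℝ) → ℝ := fun p =>
    (-(F *ᵥ p.1) + L *ᵥ p.2) ⬝ᵥ (F *ᵥ p.1) + p.1 ⬝ᵥ (F *ᵥ (-(F *ᵥ p.1) + L *ᵥ p.2))
  have hg : Continuous g := by fun_prop
  obtain ⟨M, hM⟩ := (isCompact_closedBall (0 : (ι → ℝ) × (ι → ℝ))
    (√(V 0))).exists_bound_of_continuousOn hg.continuousOn
  refine tendsto_zero_of_hasDerivAt_le_neg (M := M) (W' := fun t => g (δ t, e t)) hV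
    (fun t _ => add_nonneg (hself _) (hself _))
    (fun t ht => (hδ t ht).dotProduct_fun ((hδ t ht).mulVec_fun F)) (fun t _ => hF _)
    (fun t _ => by linarith [hF (δ t)]) (fun t ht => ?_)
  refine (abs_le.1 (hM (δ t, e t) ?_)).1
  rw [mem_closedBall_zero_iff, Prod.norm_def]
  have hVt := hVle t ht
  exact max_le
    (norm_le_of_dotProduct_self_le (by linarith [hself (e t)]))
    (norm_le_of_dotProduct_self_le (by linarith [hself (δ t)]))

end Calculus

section Laplacian

variable {ι : Type*} [Fintype ι] [DecidableEq ι] {G : SimpleGraph ι} [DecidableRel G.Adj]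

lemma SimpleGraph.sum_lapMatrix_mulVec (v : ι → ℝ) : ∑ i, (G.lapMatrix ℝ *ᵥ v) i = 0 := by
  rw [← one_dotProduct, dotProduct_mulVec, ← mulVec_transpose, (G.isSymm_lapMatrix ℝ).eq]
  have h := G.lapMatrix_mulVec_const_eq_zero (R := ℝ)
  rw [show (1 : ι → ℝ) = fun _ => 1 from rfl, h, zero_dotProduct]

/-- The range of the Laplacian of a connected graph contains every vector with zero sum. -/
lemma SimpleGraph.Connected.exists_lapMatrix_mulVec_eq (hG : G.Connected) {b : ι → ℝ}
    (hb : ∑ i, b i = 0) : ∃ v, G.lapMatrix ℝ *ᵥ v = b := by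
  have := hG.nonempty
  let A : Matrix ι ι ℝ := G.lapMatrix ℝ + Matrix.of fun _ _ => 1
  have hA : ∀ v, A *ᵥ v = G.lapMatrix ℝ *ᵥ v + fun _ => ∑ j, v j := by
    intro v
    rw [add_mulVec]
    congr 1
    ext i
    simp [mulVec, dotProduct]
  have hsum : ∀ v, ∑ i, (A *ᵥ v) i = 0 → G.lapMatrix ℝ *ᵥ v = A *ᵥ v ∧ ∑ j, v j = 0 := by
    intro v hv
    have hv0 : ∑ j, v j = 0 := by
      simpa [hA, Finset.sum_add_distrib, SimpleGraph.sum_lapMatrix_mulVec] using hv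
    refine ⟨?_, hv0⟩
    rw [hA, hv0]
    exact (add_zero _).symm
  have hinj : Function.Injective (Matrix.toLin' A) := by
    rw [← LinearMap.ker_eq_bot, LinearMap.ker_eq_bot']
    intro v hv
    rw [toLin'_apply] at hv
    obtain ⟨hLv, hv0⟩ := hsum v (by simp [hv])
    have hconst := (G.lapMatrix_mulVec_eq_zero_iff_forall_reachable).1 (hLv.trans hv)
    ext i
    have : ∑ j, v j = ∑ _j : ι, v i :=
      Finset.sum_congr rfl fun j _ => hconst j i (hG.preconnected j i)
    simpa [hv0] using this
  obtain ⟨v, hv⟩ := LinearMap.injective_iff_surjective.1 hinj b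
  rw [toLin'_apply] at hv
  exact ⟨v, (hsum v (by rw [hv, hb])).1.trans hv⟩

lemma SimpleGraph.dotProduct_lapMatrix_mulVec (v : ι → ℝ) :
    v ⬝ᵥ (G.lapMatrix ℝ *ᵥ v) =
      (∑ i, ∑ j, if G.Adj i j then (v i - v j) ^ 2 else 0) / 2 := by
  rw [← toLinearMap₂'_apply', SimpleGraph.lapMatrix_toLinearMap₂']

lemma SimpleGraph.Adj.sq_sub_le_dotProduct_lapMatrix {i j : ι} (h : G.Adj i j) (v : ι → ℝ) :
    (v i - v j) ^ 2 ≤ 2 * (v ⬝ᵥ (G.lapMatrix ℝ *ᵥ v)) := by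
  have hterm : ∀ k l, 0 ≤ if G.Adj k l then (v k - v l) ^ 2 else 0 := fun k l => by positivity
  rw [SimpleGraph.dotProduct_lapMatrix_mulVec, mul_div_cancel₀ _ two_ne_zero]
  calc (v i - v j) ^ 2 = if G.Adj i j then (v i - v j) ^ 2 else 0 := (if_pos h).symm
    _ ≤ ∑ l, if G.Adj i l then (v i - v l) ^ 2 else 0 :=
        Finset.single_le_sum (fun l _ => hterm i l) (Finset.mem_univ j)
    _ ≤ _ := Finset.single_le_sum (f := fun k => ∑ l, if G.Adj k l then (v k - v l) ^ 2 else 0)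
        (fun k _ => Finset.sum_nonneg fun l _ => hterm k l) (Finset.mem_univ i)

lemma SimpleGraph.dotProduct_lapMatrix_mulVec_nonneg (v : ι → ℝ) :
    0 ≤ v ⬝ᵥ (G.lapMatrix ℝ *ᵥ v) := by
  rw [SimpleGraph.dotProduct_lapMatrix_mulVec]
  positivity

lemma dotProduct_diagonal_mulVec (k v : ι → ℝ) :
    v ⬝ᵥ (Matrix.diagonal k *ᵥ v) = ∑ i, k i * v i ^ 2 := by
  simp only [dotProduct, mulVec_diagonal]
  exact Finset.sum_congr rfl fun i _ => by ring

lemma tendsto_zero_of_sq_le {f g : ℝ → ℝ} {l : Filter ℝ} (hfg : ∀ t, f t ^ 2 ≤ g t)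
    (hg : Tendsto g l (nhds 0)) : Tendsto f l (nhds 0) := by
  have hsqrt : Tendsto (fun t => √(g t)) l (nhds 0) := by simpa using hg.sqrt
  exact squeeze_zero_norm (fun t => Real.abs_le_sqrt (hfg t)) hsqrt

/-- On a connected graph, the quadratic form of the Laplacian plus a nonzero nonnegative diagonal
matrix controls convergence to zero. -/
lemma SimpleGraph.Connected.tendsto_zero_of_tendsto_quadraticForm (hG : G.Connected)
    {k : ι → ℝ} (hk : ∀ i, 0 ≤ k i) {i₀ : ι} (hi₀ : 0 < k i₀) {δ : ℝ → ι → ℝ} {l : Filter ℝ}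
    (h : Tendsto (fun t => δ t ⬝ᵥ ((G.lapMatrix ℝ + Matrix.diagonal k) *ᵥ δ t)) l (nhds 0)) :
    Tendsto δ l (nhds 0) := by
  simp only [add_mulVec, dotProduct_add] at h
  have hdiag : ∀ v, 0 ≤ v ⬝ᵥ (Matrix.diagonal k *ᵥ v) := fun v => by
    rw [dotProduct_diagonal_mulVec]
    exact Finset.sum_nonneg fun i _ => mul_nonneg (hk i) (sq_nonneg _)
  have hactive : Tendsto (fun t => δ t i₀) l (nhds 0) := by
    refine tendsto_zero_of_sq_le (fun t => ?_) (by simpa using h.const_mul (k i₀)⁻¹)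
    rw [inv_mul_eq_div, le_div_iff₀ hi₀, mul_comm]
    refine le_trans ?_ (le_add_of_nonneg_left (G.dotProduct_lapMatrix_mulVec_nonneg (δ t)))
    rw [dotProduct_diagonal_mulVec]
    exact Finset.single_le_sum (f := fun i => k i * δ t i ^ 2)
      (fun i _ => mul_nonneg (hk i) (sq_nonneg _)) (Finset.mem_univ i₀)
  have hadj : ∀ i j, G.Adj i j → Tendsto (fun t => δ t i - δ t j) l (nhds 0) := by
    intro i j hij
    refine tendsto_zero_of_sq_le (fun t => ?_) (by simpa using h.const_mul 2)
    linarith [hij.sq_sub_le_dotProduct_lapMatrix (δ t), hdiag (δ t)]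
  refine tendsto_pi_nhds.2 fun i => ?_
  obtain ⟨p⟩ := hG.preconnected i i₀
  induction p with
  | nil => exact hactive
  | cons hij _ ih => simpa using (hadj _ _ hij).add (ih hi₀ hactive)

end Laplacian

/-- Theorem 1: for the networked multiagent system
`ẋ = −L(G)x + L(G)ξ − K₁x + K₂c`, `ξ̇ = −L(G)x` on a connected undirected graph
`G`, with `K₂` a nonzero 0–1 matrix and `K₁ = diag(∑ⱼ k₂ᵢⱼ)`, the state `x(t)`
of every (active and passive) agent converges to `ε·1ₙ`, the average
`ε = (1ᵀK₂c)/(1ᵀK₂1)` of the applied exogenous inputs; that is,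
`δ(t) = x(t) − ε·1ₙ` asymptotically vanishes. -/
theorem active_passive_consensus {n : ℕ} (G : SimpleGraph (Fin n))
    [DecidableRel G.Adj] (hG : G.Connected)
    (L : Matrix (Fin n) (Fin n) ℝ) (hL : L = G.lapMatrix ℝ)
    (K₂ : Matrix (Fin n) (Fin n) ℝ) (hK₂ : ∀ i j, K₂ i j = 0 ∨ K₂ i j = 1)
    (hK₂ne : K₂ ≠ 0)
    (K₁ : Matrix (Fin n) (Fin n) ℝ)
    (hK₁ : K₁ = Matrix.diagonal fun i => ∑ j, K₂ i j)
    (ones : Fin n → ℝ) (hones : ones = fun _ => 1)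
    (c : Fin n → ℝ) (ε : ℝ) (hε : ε = ones ⬝ᵥ (K₂ *ᵥ c) / (ones ⬝ᵥ (K₂ *ᵥ ones)))
    (x ξ : ℝ → Fin n → ℝ)
    (hx : ∀ t : ℝ, 0 ≤ t →
      HasDerivAt x (-(L *ᵥ x t) + L *ᵥ ξ t - K₁ *ᵥ x t + K₂ *ᵥ c) t)
    (hξ : ∀ t : ℝ, 0 ≤ t → HasDerivAt ξ (-(L *ᵥ x t)) t) :
    Tendsto (fun t => x t - ε • ones) atTop (nhds 0) := by
  subst hL hK₁ hones
  set k : Fin n → ℝ := fun i => ∑ j, K₂ i j with hkdef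
  have hK₂0 : ∀ i j, 0 ≤ K₂ i j := fun i j => by rcases hK₂ i j with h | h <;> simp [h]
  have hk : ∀ i, 0 ≤ k i := fun i => Finset.sum_nonneg fun j _ => hK₂0 i j
  obtain ⟨i₀, hi₀⟩ : ∃ i, 0 < k i := by
    by_contra! hcon
    refine hK₂ne (Matrix.ext fun i j => ?_)
    exact (Finset.sum_eq_zero_iff_of_nonneg fun j _ => hK₂0 i j).1
      ((hcon i).antisymm (hk i)) j (Finset.mem_univ j)
  have hksum : 0 < ∑ i, k i :=
    Finset.sum_pos' (fun i _ => hk i) ⟨i₀, Finset.mem_univ i₀, hi₀⟩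
  have hεk : ε * ∑ i, k i = ∑ i, (K₂ *ᵥ c) i := by
    have hden : (fun _ : Fin n => (1 : ℝ)) ⬝ᵥ (K₂ *ᵥ fun _ => 1) = ∑ i, k i := by
      simp [dotProduct, mulVec, hkdef]
    rw [hε, hden, div_mul_cancel₀ _ hksum.ne']
    simp [dotProduct]
  obtain ⟨ξ₀, hξ₀⟩ := hG.exists_lapMatrix_mulVec_eq (b := ε • k - K₂ *ᵥ c) (by
    simp [Finset.sum_sub_distrib, ← Finset.mul_sum, hεk])
  refine hG.tendsto_zero_of_tendsto_quadraticForm hk hi₀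
    (tendsto_dotProduct_mulVec_zero (e := fun t => ξ t - ξ₀) (G.isSymm_lapMatrix ℝ)
      (fun v => ?_) (fun t ht => ?_) (fun t ht => ?_))
  · rw [add_mulVec, dotProduct_add, dotProduct_diagonal_mulVec]
    exact add_nonneg (G.dotProduct_lapMatrix_mulVec_nonneg v)
      (Finset.sum_nonneg fun i _ => mul_nonneg (hk i) (sq_nonneg _))
  · refine ((hx t ht).sub_const (ε • fun _ => (1 : ℝ))).congr_deriv ?_
    have hdiag : Matrix.diagonal k *ᵥ (fun _ => (1 : ℝ)) = k := by
      ext i; simp [mulVec_diagonal]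
    rw [add_mulVec, mulVec_sub, mulVec_sub, mulVec_sub, mulVec_smul, mulVec_smul, hdiag, hξ₀,
      G.lapMatrix_mulVec_const_eq_zero]
    module
  · refine ((hξ t ht).sub_const ξ₀).congr_deriv ?_
    rw [mulVec_sub, mulVec_smul, G.lapMatrix_mulVec_const_eq_zero, smul_zero, sub_zero]
end

section
/- Let F, L ∈ ℝ^{n×n} with F symmetric positive definite and L symmetric positive semidefinite, and let A = [[−F, L], [−L, 0]] ∈ ℝ^{2n×2n}. Then the eigenvalue 0 of A is semisimple: the kernel of A² equals the kernel of A, and every vector (δ, e) ∈ ker A satisfies δ = 0 and Le = 0. -/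
open Matrix

/-- A symmetric real matrix is self-adjoint for the dot product. -/
theorem Matrix.IsSymm.dotProduct_mulVec_comm {ι : Type*} [Fintype ι] {L : Matrix ι ι ℝ}
    (hL : L.IsSymm) (x y : ι → ℝ) : x ⬝ᵥ (L *ᵥ y) = (L *ᵥ x) ⬝ᵥ y := by
  rw [dotProduct_mulVec, ← mulVec_transpose, hL.eq]

/-- A vector `(δ, e)` in the kernel of `[[−F, L], [−L, 0]]` has `δ = 0` and `Le = 0`. -/
theorem Matrix.eq_zero_and_mulVec_eq_zero_of_fromBlocks_mulVec_eq_zero {ι : Type*} [Fintype ι]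
    {F L : Matrix ι ι ℝ} (hF : F.PosDef) (hL : L.IsSymm) {δ e : ι → ℝ}
    (h : fromBlocks (-F) L (-L) 0 *ᵥ Sum.elim δ e = 0) : δ = 0 ∧ L *ᵥ e = 0 := by
  rw [fromBlocks_mulVec, ← Sum.elim_zero_zero, Sum.elim_eq_iff] at h
  simp only [Sum.elim_comp_inl, Sum.elim_comp_inr, neg_mulVec, zero_mulVec, add_zero,
    neg_eq_zero] at h
  obtain ⟨h₁, h₂⟩ := h
  have hFδ : F *ᵥ δ = L *ᵥ e := neg_add_eq_zero.mp h₁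
  have hδ : δ = 0 := by
    by_contra hne
    have hpos := hF.dotProduct_mulVec_pos hne
    rw [star_trivial, hFδ, hL.dotProduct_mulVec_comm, h₂, zero_dotProduct] at hpos
    exact hpos.false
  exact ⟨hδ, by rw [← hFδ, hδ, mulVec_zero]⟩

/-- The eigenvalue `0` of `A = [[−F, L], [−L, 0]]` is semisimple:
`ker A² = ker A`, and every kernel vector `(δ, e)` satisfies `δ = 0`, `Le = 0`. -/
theorem block_matrix_zero_eigenvalue_semisimple {n : ℕ}
    (F L : Matrix (Fin n) (Fin n) ℝ) (hF : F.PosDef) (hL : L.PosSemidef)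
    (A : Matrix (Fin n ⊕ Fin n) (Fin n ⊕ Fin n) ℝ)
    (hA : A = Matrix.fromBlocks (-F) L (-L) 0) :
    (∀ v : Fin n ⊕ Fin n → ℝ, (A * A) *ᵥ v = 0 ↔ A *ᵥ v = 0) ∧
      (∀ δ e : Fin n → ℝ, A *ᵥ Sum.elim δ e = 0 → δ = 0 ∧ L *ᵥ e = 0) := by
  have hS : L.IsSymm := by simpa using hL.isHermitian
  subst hA
  refine ⟨fun v => ⟨fun h => ?_, fun h => by rw [← mulVec_mulVec, h, mulVec_zero]⟩,
    fun δ e h => eq_zero_and_mulVec_eq_zero_of_fromBlocks_mulVec_eq_zero hF hS h⟩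
  have hv := fromBlocks_mulVec (-F) L (-L) 0 v
  rw [← mulVec_mulVec, hv] at h
  obtain ⟨h₁, h₂⟩ := eq_zero_and_mulVec_eq_zero_of_fromBlocks_mulVec_eq_zero hF hS h
  rw [zero_mulVec, add_zero, neg_mulVec] at h₂
  have hLδ : L *ᵥ (v ∘ Sum.inl) = 0 := by
    rw [mulVec_neg, neg_eq_zero] at h₂
    rw [← dotProduct_self_eq_zero, ← hS.dotProduct_mulVec_comm, h₂, dotProduct_zero]
  rw [hv, h₁, zero_mulVec, add_zero, neg_mulVec, hLδ, neg_zero, Sum.elim_zero_zero]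
end
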